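/- Let A be a normal uniform algebra on a compact Hausdorff space X and let x ∈ X. Then A_x = cl(J_x) ⊕ ℂ·1 is a normal uniform algebra on X that is strongly regular at x. -/

import Mathlib

open WeakDual Topology

set_option synthInstance.maxHeartbeats 400000
set_option maxHeartbeats 1000000
set_option linter.unusedSectionVars false

noncomputable section

variable {X : Type*} [TopologicalSpace X]

/-- A uniform algebra on `X`: a closed point-separating subalgebra of `C(X, ℂ)`
(it automatically contains the constant functions, being a subalgebra). -/
def IsUniformAlgebra (A : Subalgebra ℂ C(X, ℂ)) : Prop :=
  IsClosed (A : Set C(X, ℂ)) ∧ ∀ x y : X, x ≠ y → ∃ f ∈ A, f x ≠ f y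

/-- The character of evaluation at a point `x ∈ X`. -/
def evalChar (A : Subalgebra ℂ C(X, ℂ)) (x : X) : characterSpace ℂ A :=
  ⟨{ toFun := fun f => (f : C(X, ℂ)) x
     map_add' := fun f g => rfl
     map_smul' := fun c f => rfl
     cont := (ContinuousEvalConst.continuous_eval_const x).comp continuous_subtype_val },
   ⟨by
      intro h
      have h1 : ((1 : A) : C(X, ℂ)) x = 0 := DFunLike.congr_fun h 1
      simp at h1,
    fun f g => rfl⟩⟩

/-- The continuous linear functional on `A` underlying a character,
as an element of the normed dual of `A`. -/
def charDual {A : Type*} [NonUnitalNonAssocSemiring A] [TopologicalSpace A] [Module ℂ A]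
    (φ : characterSpace ℂ A) : A →L[ℂ] ℂ := φ.1

/-- The set `J_φ` of elements of `A` whose Gelfand transform vanishes on a
neighborhood of `φ` in the maximal ideal space of `A`. -/
def vanishNearSet (A : Subalgebra ℂ C(X, ℂ)) (φ : characterSpace ℂ A) : Set A :=
  {f | ∃ U ∈ 𝓝 φ, ∀ ψ ∈ U, ψ f = 0}

/-- `A` is normal on `X`: disjoint closed sets are separated by a `0`-`1` valued
pair of values of some function in `A`. -/
def IsNormalOn (A : Subalgebra ℂ C(X, ℂ)) : Prop :=
  ∀ K₀ K₁ : Set X, IsClosed K₀ → IsClosed K₁ → Disjoint K₀ K₁ →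
    ∃ f ∈ A, (∀ x ∈ K₀, f x = 0) ∧ (∀ x ∈ K₁, f x = 1)

/-- `A` is strongly regular at `x`: `J_x` is dense in `M_x`. -/
def StronglyRegularAt (A : Subalgebra ℂ C(X, ℂ)) (x : X) : Prop :=
  {f : A | (f : C(X, ℂ)) x = 0} ⊆ closure (vanishNearSet A (evalChar A x))

/-- `d` is a point derivation sequence of order `n` at `φ`: `d⁰ = φ` and the
Leibniz identities hold for `1 ≤ k ≤ n` (linearity/continuity of the `d k` is
imposed by the type at which this is used). -/
def IsDerivSeq {A : Type*} [Mul A] (φ : A → ℂ) (n : ℕ∞) (d : ℕ → A → ℂ) : Prop :=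
  (∀ f, d 0 f = φ f) ∧
  ∀ k : ℕ, 1 ≤ k → (k : ℕ∞) ≤ n → ∀ f g,
    d k (f * g) = ∑ j ∈ Finset.range (k + 1), d j f * d (k - j) g

variable [CompactSpace X]

/-- `A` has bounded relative units at `x`. -/
def HasBoundedRelativeUnits (A : Subalgebra ℂ C(X, ℂ)) (x : X) : Prop :=
  ∃ C : ℝ, 0 < C ∧ ∀ K : Set X, IsCompact K → x ∉ K →
    ∃ f : A, f ∈ vanishNearSet A (evalChar A x) ∧
      (∀ y ∈ K, (f : C(X, ℂ)) y = 1) ∧ ‖(f : C(X, ℂ))‖ ≤ C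

/-- `x` is a generalized peak point for `A`. -/
def IsGeneralizedPeakPoint (A : Subalgebra ℂ C(X, ℂ)) (x : X) : Prop :=
  ∀ U ∈ 𝓝 x, ∃ f ∈ A, f x = 1 ∧ ‖f‖ = 1 ∧ ∀ y ∉ U, ‖f y‖ < 1

/-- `P` is a Gleason part for `A`: the set of all characters at dual-norm
distance `< 2` from some fixed character. -/
def IsGleasonPart (A : Subalgebra ℂ C(X, ℂ)) (P : Set (characterSpace ℂ A)) : Prop :=
  ∃ φ : characterSpace ℂ A, P = {ψ | ‖charDual φ - charDual ψ‖ < 2}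

/-- The carrier set of Feinstein's algebra `A_x = cl(J_x) ⊕ ℂ·1`. -/
def feinsteinSet (A : Subalgebra ℂ C(X, ℂ)) (x : X) : Set C(X, ℂ) :=
  {h | ∃ g ∈ closure ((fun f : A => (f : C(X, ℂ))) '' vanishNearSet A (evalChar A x)),
    ∃ c : ℂ, h = g + algebraMap ℂ C(X, ℂ) c}

section Normal

variable {X : Type*} [TopologicalSpace X] [CompactSpace X]

/-- For every character `φ` there is a point `y` such that `φ` kills all functions of the algebra
vanishing near `y`. -/
theorem exists_point_forall_eventually_eq_zero (A : Subalgebra ℂ C(X, ℂ))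
    (φ : characterSpace ℂ A) :
    ∃ y : X, ∀ f : A, (∀ᶠ z in 𝓝 y, (f : C(X, ℂ)) z = 0) → φ f = 0 := by
  by_contra! h
  choose f hf hφ using h
  obtain ⟨t, -, ht⟩ := isCompact_univ.elim_nhds_subcover
    (fun y => {z | (f y : C(X, ℂ)) z = 0}) (fun y _ => hf y)
  have hprod : ∏ y ∈ t, f y = 0 := by
    ext z
    obtain ⟨y, hy, hz⟩ := Set.mem_iUnion₂.1 (ht (Set.mem_univ z))
    have h1 : evalChar A z (∏ y ∈ t, f y) = 0 := by
      rw [map_prod]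
      exact Finset.prod_eq_zero hy hz
    exact h1
  have h2 : φ (∏ y ∈ t, f y) ≠ 0 := by
    rw [map_prod]
    exact Finset.prod_ne_zero_iff.2 fun y _ => hφ y
  exact h2 (by rw [hprod, map_zero])

variable [T2Space X]

/-- Every character of a normal algebra is evaluation at a point. -/
theorem IsNormalOn.evalChar_surjective {A : Subalgebra ℂ C(X, ℂ)} (hA : IsNormalOn A) :
    Function.Surjective (evalChar A) := by
  intro φ
  obtain ⟨y, hy⟩ := exists_point_forall_eventually_eq_zero A φ
  have key : ∀ f : A, (f : C(X, ℂ)) y = 0 → φ f = 0 := by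
    intro f hf
    by_contra hne
    have hpos : 0 < ‖φ f‖ / 2 := by positivity
    set U : Set X := {z | ‖(f : C(X, ℂ)) z‖ < ‖φ f‖ / 2}
    have hU : IsOpen U := isOpen_lt (by fun_prop) continuous_const
    have hyU : y ∈ U := by simpa [U, hf] using hne
    obtain ⟨V, hV, hVc, hVU⟩ := exists_mem_nhds_isClosed_subset (hU.mem_nhds hyU)
    obtain ⟨h, hhA, h0, h1⟩ := hA Uᶜ V hU.isClosed_compl hVc
      (Set.disjoint_left.2 fun z hz hzV => hz (hVU hzV))
    have hφh : φ (⟨h, hhA⟩ : A) = 1 := by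
      have := hy (1 - ⟨h, hhA⟩) (Filter.mem_of_superset hV fun z hz => by simp [h1 z hz])
      rw [map_sub, map_one, sub_eq_zero] at this
      exact this.symm
    have hbound : ∀ n : ℕ, ‖φ f‖ ^ n ≤ ‖charDual φ‖ * ((‖φ f‖ / 2) ^ n * ‖h‖) := by
      intro n
      have hn : ‖(f ^ n * ⟨h, hhA⟩ : A)‖ ≤ (‖φ f‖ / 2) ^ n * ‖h‖ := by
        change ‖(f : C(X, ℂ)) ^ n * h‖ ≤ _
        refine (ContinuousMap.norm_le _ (by positivity)).2 fun z => ?_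
        rw [ContinuousMap.mul_apply, ContinuousMap.pow_apply, norm_mul, norm_pow]
        by_cases hz : z ∈ U
        · exact mul_le_mul (pow_le_pow_left₀ (norm_nonneg _) (le_of_lt hz) n)
            (h.norm_coe_le_norm z) (norm_nonneg _) (by positivity)
        · rw [h0 z hz]
          simp only [norm_zero, mul_zero]
          positivity
      calc ‖φ f‖ ^ n = ‖charDual φ (f ^ n * ⟨h, hhA⟩)‖ := by
            change _ = ‖φ _‖
            rw [map_mul, map_pow, hφh, mul_one, norm_pow]
        _ ≤ ‖charDual φ‖ * ‖(f ^ n * ⟨h, hhA⟩ : A)‖ := (charDual φ).le_opNorm _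
        _ ≤ _ := by gcongr
    obtain ⟨n, hn⟩ := pow_unbounded_of_one_lt (‖charDual φ‖ * ‖h‖) (one_lt_two : (1 : ℝ) < 2)
    have hp : 0 < ‖φ f‖ ^ n := by positivity
    have := hbound n
    rw [div_pow, div_mul_eq_mul_div, mul_div_assoc', le_div_iff₀ (by positivity)] at this
    nlinarith
  refine ⟨y, ?_⟩
  ext f
  have := key (f - algebraMap ℂ A ((f : C(X, ℂ)) y)) (by simp)
  rw [map_sub, AlgHomClass.commutes, sub_eq_zero] at this
  exact this.symm

theorem continuous_evalChar (A : Subalgebra ℂ C(X, ℂ)) : Continuous (evalChar A) :=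
  continuous_induced_rng.2
    (WeakDual.continuous_of_continuous_eval fun f => (f : C(X, ℂ)).continuous)

/-- For a normal algebra, vanishing near `evalChar A x` in the maximal ideal space is the same as
vanishing near `x`. -/
theorem IsNormalOn.mem_vanishNearSet_iff {A : Subalgebra ℂ C(X, ℂ)} (hA : IsNormalOn A) {x : X}
    {f : A} :
    f ∈ vanishNearSet A (evalChar A x) ↔ ∀ᶠ z in 𝓝 x, (f : C(X, ℂ)) z = 0 := by
  constructor
  · rintro ⟨U, hU, hf⟩
    exact Filter.mem_of_superset ((continuous_evalChar A).continuousAt hU) fun z hz => hf _ hz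
  · intro hf
    obtain ⟨U, hUf, hU, hxU⟩ := mem_nhds_iff.1 hf
    refine ⟨(evalChar A '' Uᶜ)ᶜ, IsOpen.mem_nhds ?_ ?_, ?_⟩
    · exact (hU.isClosed_compl.isCompact.image (continuous_evalChar A)).isClosed.isOpen_compl
    · rintro ⟨z, hz, hzx⟩
      obtain ⟨g, hg, h0, h1⟩ := hA {z} {x} isClosed_singleton isClosed_singleton
        (Set.disjoint_singleton.2 fun h => hz (h ▸ hxU))
      have : g z = g x := DFunLike.congr_fun hzx (⟨g, hg⟩ : A)
      simp [h0 z rfl, h1 x rfl] at this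
    · intro ψ hψ
      obtain ⟨z, rfl⟩ := hA.evalChar_surjective ψ
      exact hUf (by_contra fun hz => hψ ⟨z, hz, rfl⟩)

/-- The functions of `A` vanishing near `x`. -/
def vanishNearSubalgebra (A : Subalgebra ℂ C(X, ℂ)) (x : X) : NonUnitalSubalgebra ℂ C(X, ℂ) where
  carrier := {f | f ∈ A ∧ ∀ᶠ z in 𝓝 x, f z = 0}
  add_mem' := fun hf hg => ⟨A.add_mem hf.1 hg.1, by
    filter_upwards [hf.2, hg.2] with z h1 h2
    simp [h1, h2]⟩
  zero_mem' := ⟨A.zero_mem, by simp⟩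
  mul_mem' := fun hf hg => ⟨A.mul_mem hf.1 hg.1, by
    filter_upwards [hf.2] with z h1
    simp [h1]⟩
  smul_mem' := fun c f hf => ⟨A.smul_mem hf.1 c, by
    filter_upwards [hf.2] with z h1
    simp [h1]⟩

theorem IsNormalOn.image_vanishNearSet {A : Subalgebra ℂ C(X, ℂ)} (hA : IsNormalOn A) (x : X) :
    (fun f : A => (f : C(X, ℂ))) '' vanishNearSet A (evalChar A x) =
      vanishNearSubalgebra A x := by
  ext f
  constructor
  · rintro ⟨g, hg, rfl⟩
    exact ⟨g.2, hA.mem_vanishNearSet_iff.1 hg⟩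
  · rintro ⟨hf, h⟩
    exact ⟨⟨f, hf⟩, hA.mem_vanishNearSet_iff.2 h, rfl⟩

theorem apply_eq_zero_of_mem_closure_vanishNearSubalgebra {A : Subalgebra ℂ C(X, ℂ)} {x : X}
    {f : C(X, ℂ)} (hf : f ∈ (vanishNearSubalgebra A x).topologicalClosure) : f x = 0 := by
  have hc : IsClosed {g : C(X, ℂ) | g x = 0} :=
    isClosed_eq (ContinuousEvalConst.continuous_eval_const x) continuous_const
  exact closure_minimal (fun g hg => hg.2.self_of_nhds) hc hf

/-- Feinstein's algebra `A_x`, as the functions `f` for which `f - f x` is a limit of functions of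
`A` vanishing near `x`. -/
def feinsteinAlgebra (A : Subalgebra ℂ C(X, ℂ)) (x : X) : Subalgebra ℂ C(X, ℂ) where
  carrier := {f | f - algebraMap ℂ C(X, ℂ) (f x) ∈ (vanishNearSubalgebra A x).topologicalClosure}
  add_mem' := by
    intro f g hf hg
    have h : f + g - algebraMap ℂ C(X, ℂ) ((f + g) x) =
        (f - algebraMap ℂ C(X, ℂ) (f x)) + (g - algebraMap ℂ C(X, ℂ) (g x)) := by
      ext z
      simp
      ring
    rw [Set.mem_ofPred_eq, h]
    exact add_mem hf hg
  mul_mem' := by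
    intro f g hf hg
    have h : f * g - algebraMap ℂ C(X, ℂ) ((f * g) x) =
        (f - algebraMap ℂ C(X, ℂ) (f x)) * (g - algebraMap ℂ C(X, ℂ) (g x)) +
          (g x • (f - algebraMap ℂ C(X, ℂ) (f x)) +
            f x • (g - algebraMap ℂ C(X, ℂ) (g x))) := by
      ext z
      simp
      ring
    rw [Set.mem_ofPred_eq, h]
    exact add_mem (mul_mem hf hg) (add_mem (SMulMemClass.smul_mem _ hf)
      (SMulMemClass.smul_mem _ hg))
  algebraMap_mem' := by
    intro c
    have h : algebraMap ℂ C(X, ℂ) c - algebraMap ℂ C(X, ℂ) ((algebraMap ℂ C(X, ℂ) c) x) = 0 := by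
      ext z
      simp
    rw [Set.mem_ofPred_eq, h]
    exact zero_mem _

theorem IsNormalOn.coe_feinsteinAlgebra {A : Subalgebra ℂ C(X, ℂ)} (hA : IsNormalOn A) (x : X) :
    (feinsteinAlgebra A x : Set C(X, ℂ)) = feinsteinSet A x := by
  ext f
  rw [feinsteinSet, hA.image_vanishNearSet]
  constructor
  · intro hf
    exact ⟨_, hf, f x, (sub_add_cancel _ _).symm⟩
  · rintro ⟨g, hg, c, rfl⟩
    have hgx : g x = 0 := apply_eq_zero_of_mem_closure_vanishNearSubalgebra hg
    have h : g + algebraMap ℂ C(X, ℂ) c -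
        algebraMap ℂ C(X, ℂ) ((g + algebraMap ℂ C(X, ℂ) c) x) = g := by
      ext z
      simp [hgx]
    change _ ∈ (vanishNearSubalgebra A x).topologicalClosure
    rw [h]
    exact hg

theorem isClosed_feinsteinAlgebra (A : Subalgebra ℂ C(X, ℂ)) (x : X) :
    IsClosed (feinsteinAlgebra A x : Set C(X, ℂ)) := by
  have hc : Continuous fun f : C(X, ℂ) => f - algebraMap ℂ C(X, ℂ) (f x) :=
    continuous_id.sub ((continuous_algebraMap ℂ C(X, ℂ)).comp
      (ContinuousEvalConst.continuous_eval_const x))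
  exact (vanishNearSubalgebra A x).isClosed_topologicalClosure.preimage hc

theorem vanishNearSubalgebra_le_feinsteinAlgebra {A : Subalgebra ℂ C(X, ℂ)} {x : X}
    {f : C(X, ℂ)} (hf : f ∈ vanishNearSubalgebra A x) : f ∈ feinsteinAlgebra A x := by
  have hfx : f x = 0 := hf.2.self_of_nhds
  change f - algebraMap ℂ C(X, ℂ) (f x) ∈ (vanishNearSubalgebra A x).topologicalClosure
  rw [hfx, map_zero, sub_zero]
  exact subset_closure hf

theorem IsNormalOn.feinsteinAlgebra {A : Subalgebra ℂ C(X, ℂ)} (hA : IsNormalOn A) (x : X) :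
    IsNormalOn (feinsteinAlgebra A x) := by
  have key : ∀ K₀ K₁ : Set X, IsClosed K₀ → IsClosed K₁ → Disjoint K₀ K₁ → x ∉ K₁ →
      ∃ f ∈ _root_.feinsteinAlgebra A x, (∀ y ∈ K₀, f y = 0) ∧ (∀ y ∈ K₁, f y = 1) := by
    intro K₀ K₁ h₀ h₁ hd hx
    obtain ⟨V, hV, hVc, hVK⟩ := exists_mem_nhds_isClosed_subset (h₁.isOpen_compl.mem_nhds hx)
    obtain ⟨f, hf, hf0, hf1⟩ := hA (K₀ ∪ V) K₁ (h₀.union hVc) h₁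
      (hd.union_left (Set.disjoint_left.2 hVK))
    exact ⟨f, vanishNearSubalgebra_le_feinsteinAlgebra
      ⟨hf, Filter.mem_of_superset hV fun z hz => hf0 z (Or.inr hz)⟩,
      fun y hy => hf0 y (Or.inl hy), hf1⟩
  intro K₀ K₁ h₀ h₁ hd
  by_cases hx : x ∈ K₁
  · obtain ⟨f, hf, hf0, hf1⟩ := key K₁ K₀ h₁ h₀ hd.symm (Set.disjoint_right.1 hd hx)
    exact ⟨1 - f, sub_mem (one_mem _) hf, fun y hy => by simp [hf1 y hy],
      fun y hy => by simp [hf0 y hy]⟩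
  · exact key K₀ K₁ h₀ h₁ hd hx

theorem IsNormalOn.stronglyRegularAt_feinsteinAlgebra {A : Subalgebra ℂ C(X, ℂ)}
    (hA : IsNormalOn A) (x : X) : StronglyRegularAt (_root_.feinsteinAlgebra A x) x := by
  intro f hfx
  have hf : (f : C(X, ℂ)) ∈ (vanishNearSubalgebra A x).topologicalClosure := by
    have h : (f : C(X, ℂ)) - algebraMap ℂ C(X, ℂ) ((f : C(X, ℂ)) x) ∈
      (vanishNearSubalgebra A x).topologicalClosure := f.2
    rwa [hfx, map_zero, sub_zero] at h
  rw [closure_subtype]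
  refine closure_mono ?_ hf
  intro g hg
  exact ⟨⟨g, vanishNearSubalgebra_le_feinsteinAlgebra hg⟩,
    (hA.feinsteinAlgebra x).mem_vanishNearSet_iff.2 hg.2, rfl⟩

theorem IsNormalOn.separates {A : Subalgebra ℂ C(X, ℂ)} (hA : IsNormalOn A) {x y : X}
    (hxy : x ≠ y) : ∃ f ∈ A, f x ≠ f y := by
  obtain ⟨f, hf, h0, h1⟩ := hA {x} {y} isClosed_singleton isClosed_singleton
    (Set.disjoint_singleton.2 hxy)
  exact ⟨f, hf, by simp [h0 x rfl, h1 y rfl]⟩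

end Normal

/-- For a normal uniform algebra `A` on `X` and `x ∈ X`, the set
`A_x = cl(J_x) ⊕ ℂ·1` is (the carrier of) a normal uniform algebra on `X` that is
strongly regular at `x`. -/
theorem feinstein_algebra_normal_stronglyRegular
    {X : Type*} [TopologicalSpace X] [CompactSpace X] [T2Space X]
    (A : Subalgebra ℂ C(X, ℂ)) (hA : IsUniformAlgebra A) (hnormal : IsNormalOn A)
    (x : X) :
    ∃ B : Subalgebra ℂ C(X, ℂ), (B : Set C(X, ℂ)) = feinsteinSet A x ∧
      IsUniformAlgebra B ∧ IsNormalOn B ∧ StronglyRegularAt B x := by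
  exact ⟨feinsteinAlgebra A x, hnormal.coe_feinsteinAlgebra x,
    ⟨isClosed_feinsteinAlgebra A x, fun _ _ h => (hnormal.feinsteinAlgebra x).separates h⟩,
    hnormal.feinsteinAlgebra x, hnormal.stronglyRegularAt_feinsteinAlgebra x⟩

end
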